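/- There exists a constant p_0 > 0 such that for all 0 < p ≤ p_0 and all x with 0 ≤ x ≤ 1 − p, one has I_p(p + x) ≥ x^2 · I_p(1 − 1/log(1/p)). -/

import Mathlib

/-- The relative entropy function `I_p(y) = y log(y/p) + (1-y) log((1-y)/(1-p))`. -/
noncomputable def Ient (p y : ℝ) : ℝ :=
  y * Real.log (y / p) + (1 - y) * Real.log ((1 - y) / (1 - p))

/-- Lower bound for the relative entropy obtained by linearizing its second term. -/
lemma Ient_ge_mul_log_sub {p y : ℝ} (hp1 : p < 1) (hy : y ≤ 1) :
    y * Real.log (y / p) - (y - p) ≤ Ient p y := by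
  unfold Ient
  rcases hy.eq_or_lt with rfl | hy
  · simp only [sub_self, zero_mul, add_zero]
    linarith
  · have h1 : 0 < 1 - y := by linarith
    have h2 : 0 < 1 - p := by linarith
    have h := mul_le_mul_of_nonneg_left
      (Real.one_sub_inv_le_log_of_pos (div_pos h1 h2)) h1.le
    have e : (1 - y) * (1 - ((1 - y) / (1 - p))⁻¹) = -(y - p) := by
      field_simp
      ring
    linarith

lemma sub_add_sq_div_le_mul_log {p y : ℝ} (hp : 0 < p) (hpy : p ≤ y) :
    (y - p) + (y - p) ^ 2 / (2 * y) ≤ y * Real.log (y / p) := by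
  have hy : 0 < y := by linarith
  have h0 : 0 ≤ (y - p) / p := div_nonneg (by linarith) hp.le
  have h := Real.le_log_one_add_of_nonneg h0
  have e1 : 1 + (y - p) / p = y / p := by
    field_simp
    ring
  have e2 : 2 * ((y - p) / p) / ((y - p) / p + 2) = 2 * (y - p) / (y + p) := by
    have : (y - p) / p + 2 = (y + p) / p := by
      field_simp
      ring
    rw [this]
    field_simp
  rw [e1, e2] at h
  refine le_trans ?_ (mul_le_mul_of_nonneg_left h hy.le)
  rw [← sub_nonneg]
  have e3 : y * (2 * (y - p) / (y + p)) - ((y - p) + (y - p) ^ 2 / (2 * y))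
      = (y - p) ^ 3 / (2 * y * (y + p)) := by
    field_simp
    ring
  rw [e3]
  have : 0 ≤ y - p := by linarith
  positivity

lemma neg_log_le_mul_one_sub {M y : ℝ} (hM : 3 ≤ M) (hy : 1 ≤ 2 * M * y) (hy1 : y ≤ 1) :
    -Real.log y ≤ M * (1 - y) := by
  have hy0 : 0 < y := by
    by_contra! h
    nlinarith
  rcases le_total 1 (M * y) with h | h
  · have h1 := Real.one_sub_inv_le_log_of_pos hy0
    have h2 : y⁻¹ ≤ M := by
      rw [inv_le_iff_one_le_mul₀ hy0]
      linarith
    have h3 : y⁻¹ - 1 = y⁻¹ * (1 - y) := by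
      field_simp
    nlinarith
  · have h1 : Real.log y⁻¹ ≤ Real.log (2 * M) := by
      apply Real.log_le_log (inv_pos.2 hy0)
      rw [inv_le_iff_one_le_mul₀ hy0]
      linarith
    have h2 : Real.log (2 * M) = 2 * Real.log 2 + Real.log (M / 2) := by
      have : 2 * M = 2 ^ 2 * (M / 2) := by ring
      rw [this, Real.log_mul (by norm_num) (by positivity), Real.log_pow]
      norm_num
    have h3 := Real.log_le_sub_one_of_pos (show 0 < M / 2 by positivity)
    have h4 := Real.log_two_lt_d9
    rw [Real.log_inv] at h1
    nlinarith

lemma sq_mul_log_inv_sub_one_le_Ient {p y : ℝ} (hp : 0 < p) (hL : 4 ≤ Real.log (1 / p))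
    (hpy : p ≤ y) (hy1 : y ≤ 1) :
    (y - p) ^ 2 * (Real.log (1 / p) - 1) ≤ Ient p y := by
  have hp1 : p < 1 := by
    by_contra! h
    have : Real.log (1 / p) ≤ 0 :=
      Real.log_nonpos (by positivity) ((div_le_one hp).2 h)
    linarith
  have hy0 : 0 < y := by linarith
  refine le_trans ?_ (Ient_ge_mul_log_sub hp1 hy1)
  obtain ⟨M, hM⟩ : ∃ M, M = Real.log (1 / p) - 1 := ⟨_, rfl⟩
  rw [← hM]
  rcases le_total (2 * M * y) 1 with h | h
  · have h1 := sub_add_sq_div_le_mul_log hp hpy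
    have h2 : (y - p) ^ 2 * M ≤ (y - p) ^ 2 / (2 * y) := by
      rw [le_div_iff₀ (by positivity)]
      nlinarith [mul_le_mul_of_nonneg_left h (sq_nonneg (y - p))]
    linarith
  · have h1 := mul_le_mul_of_nonneg_left
      (neg_log_le_mul_one_sub (by linarith) h hy1) hy0.le
    have h2 : Real.log (y / p) = Real.log y + (M + 1) := by
      rw [Real.log_div hy0.ne' hp.ne', hM, one_div, Real.log_inv]
      ring
    have h3 : 0 ≤ M * p * (2 * y - p) :=
      mul_nonneg (mul_nonneg (by linarith) hp.le) (by linarith)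
    rw [h2]
    nlinarith

lemma Ient_one_sub_inv_log_le {p : ℝ} (hp : 0 < p) (hp2 : p ≤ 1 / 2)
    (hL : 4 ≤ Real.log (1 / p)) :
    Ient p (1 - 1 / Real.log (1 / p)) ≤ Real.log (1 / p) - 1 := by
  unfold Ient
  obtain ⟨L, hLdef⟩ : ∃ L, L = Real.log (1 / p) := ⟨_, rfl⟩
  rw [← hLdef] at hL ⊢
  have hL0 : 0 < L := by linarith
  have hlt : 1 / L < 1 := (div_lt_one hL0).2 (by linarith)
  have hpos : 0 < 1 - 1 / L := by linarith
  have h1 : Real.log ((1 - 1 / L) / p) ≤ L := by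
    refine (Real.log_le_log (div_pos hpos hp) ?_).trans hLdef.ge
    gcongr
    exact sub_le_self 1 (by positivity)
  have h2 : Real.log ((1 - (1 - 1 / L)) / (1 - p)) ≤ 0 := by
    have hq : (0 : ℝ) < 1 - p := by linarith
    rw [sub_sub_cancel]
    apply Real.log_nonpos (by positivity)
    rw [div_div, div_le_one (by positivity)]
    nlinarith
  have h3 := mul_le_mul_of_nonneg_left h1 hpos.le
  have h4 : (1 - 1 / L) * L = L - 1 := by
    field_simp
  have h5 : (1 - (1 - 1 / L)) * Real.log ((1 - (1 - 1 / L)) / (1 - p)) ≤ 0 :=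
    mul_nonpos_of_nonneg_of_nonpos (by rw [sub_sub_cancel]; positivity) h2
  linarith

/-- There exists `p₀ > 0` such that for all `0 < p ≤ p₀` and all `0 ≤ x ≤ 1 − p`,
one has `I_p(p + x) ≥ x² · I_p(1 − 1/log(1/p))`. -/
theorem Ient_sq_lower : ∃ p₀ : ℝ, 0 < p₀ ∧
    ∀ p : ℝ, 0 < p → p ≤ p₀ →
      ∀ x : ℝ, 0 ≤ x → x ≤ 1 - p →
        x ^ 2 * Ient p (1 - 1 / Real.log (1 / p)) ≤ Ient p (p + x) := by
  refine ⟨Real.exp (-4), Real.exp_pos _, fun p hp hp0 x hx hx1 => ?_⟩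
  have hL : 4 ≤ Real.log (1 / p) := by
    have := (Real.log_le_iff_le_exp hp).2 hp0
    rw [one_div, Real.log_inv]
    linarith
  have hp2 : p ≤ 1 / 2 := by
    have h := Real.log_le_sub_one_of_pos (show 0 < 1 / p by positivity)
    have h2 : 2 ≤ 1 / p := by linarith
    rw [le_div_iff₀ hp] at h2
    linarith
  have h := sq_mul_log_inv_sub_one_le_Ient hp hL (show p ≤ p + x by linarith) (by linarith)
  rw [add_sub_cancel_left] at h
  exact (mul_le_mul_of_nonneg_left (Ient_one_sub_inv_log_le hp hp2 hL) (sq_nonneg x)).trans h
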